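/- For every x ∈ e + ker ad(f), the skew-symmetric bilinear form B on 𝔤 × ker ad(f) defined by B((u₁,v₁),(u₂,v₂)) = −κ(x,⁅u₁,u₂⁆) − κ(u₁,v₂) + κ(u₂,v₁) is nondegenerate: for every nonzero pair (u,v) ∈ 𝔤 × ker ad(f) there exists (u',v') ∈ 𝔤 × ker ad(f) with B((u,v),(u',v')) ≠ 0. -/

import Mathlib

open Module LieModule

section Eigenvectors

variable {K V : Type*} [Field K] [AddCommGroup V] [Module K V]

lemma exists_eigenvector_mem_of_mem_maxGenEigenspace (T : End K V) {p : Submodule K V}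
    (hp : ∀ x ∈ p, T x ∈ p) {μ : K} {x : V} (hx : x ∈ p) (hxμ : x ∈ T.maxGenEigenspace μ)
    (hx0 : x ≠ 0) : ∃ m ∈ p, m ≠ 0 ∧ T m = μ • m := by
  obtain ⟨k, hk⟩ := (End.mem_maxGenEigenspace T μ x).mp hxμ
  obtain ⟨n, hn, hn'⟩ := Nat.exists_not_and_succ_of_not_zero_of_exists
    (p := fun k ↦ ((T - μ • (1 : End K V)) ^ k) x = 0) (by simpa using hx0) ⟨k, hk⟩
  refine ⟨((T - μ • (1 : End K V)) ^ n) x, ?_, hn, ?_⟩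
  · clear hn hn'
    induction n with
    | zero => simpa using hx
    | succ n ih =>
      rw [pow_succ', End.mul_apply]
      simpa using p.sub_mem (hp _ ih) (p.smul_mem μ ih)
  · rw [pow_succ', End.mul_apply] at hn'
    simpa [sub_eq_zero] using hn'

lemma exists_eigenvector_mem [IsAlgClosed K] [FiniteDimensional K V] (T : End K V)
    {p : Submodule K V} (hp : ∀ x ∈ p, T x ∈ p) (hp0 : p ≠ ⊥) :
    ∃ (μ : K), ∃ m ∈ p, m ≠ 0 ∧ T m = μ • m := by
  have : Nontrivial p := Submodule.nontrivial_iff_ne_bot.mpr hp0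
  obtain ⟨μ, hμ⟩ := End.exists_eigenvalue (T.restrict hp)
  obtain ⟨m, hm⟩ := hμ.exists_hasEigenvector
  exact ⟨μ, m, m.2, by simpa using hm.2, by simpa using congr_arg Subtype.val hm.apply_eq_smul⟩

end Eigenvectors

namespace IsSl2Triple

variable {K L M : Type*} [Field K] [LieRing L] [LieAlgebra K L]
  [AddCommGroup M] [Module K M] [LieRingModule L M] [LieModule K L M] {h e f : L}

lemma lie_h_mem_ker_f (t : IsSl2Triple h e f) {x : M} (hx : x ∈ (toEnd K L M f).ker) :
    toEnd K L M h x ∈ (toEnd K L M f).ker := by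
  replace hx : ⁅f, x⁆ = 0 := hx
  have : ⁅f, ⁅h, x⁆⁆ = ⁅h, ⁅f, x⁆⁆ - ⁅⁅h, f⁆, x⁆ := by rw [lie_lie h f]; abel
  simp [this, hx, t.lie_lie_smul_f K]

lemma lie_h_mem_range_f (t : IsSl2Triple h e f) {x : M} (hx : x ∈ (toEnd K L M f).range) :
    toEnd K L M h x ∈ (toEnd K L M f).range := by
  obtain ⟨y, rfl⟩ := hx
  refine ⟨⁅h, y⁆ - (2 : K) • y, ?_⟩
  have : ⁅h, ⁅f, y⁆⁆ = ⁅⁅h, f⁆, y⁆ + ⁅f, ⁅h, y⁆⁆ := leibniz_lie h f y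
  simp [this, t.lie_lie_smul_f K]
  abel

variable (K M) in
lemma lie_h_pow_toEnd_e_apply (t : IsSl2Triple h e f) (k : ℕ) (w : M) :
    ⁅h, (toEnd K L M e ^ k) w⁆ =
      (toEnd K L M e ^ k) ⁅h, w⁆ + (2 * k : K) • (toEnd K L M e ^ k) w := by
  induction k with
  | zero => simp
  | succ k ih =>
    rw [pow_succ', End.mul_apply, End.mul_apply, toEnd_apply_apply, toEnd_apply_apply,
      leibniz_lie, t.lie_h_e_smul K, ih, smul_lie, lie_add, lie_smul]
    push_cast
    module

variable (K M) in
lemma isNilpotent_toEnd_e [CharZero K] [FiniteDimensional K M] (t : IsSl2Triple h e f) :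
    IsNilpotent (toEnd K L M e) := by
  set E := toEnd K L M e
  set H := toEnd K L M h
  by_contra contra
  have hE (n : ℕ) : E ^ n ≠ 0 := fun h0 ↦ contra ⟨n, h0⟩
  set T : End K (End K M) := LinearMap.mulLeft K H - LinearMap.mulRight K H
  have hT (n : ℕ) : T (E ^ n) = (2 * n : K) • E ^ n := by
    ext w
    simp [T, H, E, t.lie_h_pow_toEnd_e_apply K M]
  set evals : ℕ → K := fun n ↦ 2 * n
  have h_inj : Function.Injective evals := fun a b hab ↦ by simpa [evals] using hab
  have aux (μ : Set.range evals) : T.HasEigenvector μ (E ^ μ.property.choose) := by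
    refine ⟨?_, hE _⟩
    rw [End.mem_eigenspace_iff, hT]
    congr 1
    exact μ.property.choose_spec
  have := (T.eigenvectors_linearIndependent (Set.range evals) _ aux).finite
  exact Set.infinite_range_of_injective h_inj (Set.toFinite _)

lemma lie_f_pow_succ_toEnd_e_of_lie_e_lie_f (t : IsSl2Triple h e f) {w : M}
    (hw : ⁅e, ⁅f, w⁆⁆ = 0) (k : ℕ) :
    ⁅f, (toEnd K L M e ^ (k + 1)) w⁆ =
      -(k + 1 : K) • (toEnd K L M e ^ k) (⁅h, w⁆ + (k : K) • w) := by
  have hfe (m : M) : ⁅f, ⁅e, m⁆⁆ = ⁅e, ⁅f, m⁆⁆ - ⁅h, m⁆ := by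
    rw [← t.lie_e_f, lie_lie]; abel
  induction k with
  | zero => simp [hfe, hw]
  | succ k ih =>
    rw [pow_succ', End.mul_apply, toEnd_apply_apply, hfe, ih, t.lie_h_pow_toEnd_e_apply K M,
      lie_smul, ← toEnd_apply_apply K L M e, ← End.mul_apply, ← pow_succ', map_add, map_add,
      map_smul, map_smul]
    push_cast
    module

lemma lie_f_eq_zero_of_pow_toEnd_e_eq_zero [CharZero K] (t : IsSl2Triple h e f) {n : ℕ} (k : ℕ)
    {w : M} (hk : (toEnd K L M e ^ k) w = 0) (hw : ⁅e, ⁅f, w⁆⁆ = 0)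
    (hn : ⁅h, ⁅f, w⁆⁆ = (n : K) • ⁅f, w⁆) : ⁅f, w⁆ = 0 := by
  induction k generalizing w with
  | zero => simp_all
  | succ k ih =>
    have hk0 : (k + 1 : K) ≠ 0 := by exact_mod_cast k.succ_ne_zero
    have key := t.lie_f_pow_succ_toEnd_e_of_lie_e_lie_f (K := K) hw k
    rw [hk, lie_zero, eq_comm, smul_eq_zero_iff_right (neg_ne_zero.mpr hk0)] at key
    have hfw : ⁅f, ⁅h, w⁆ + (k : K) • w⁆ = (n + 2 + k : K) • ⁅f, w⁆ := by
      have : ⁅f, ⁅h, w⁆⁆ = ⁅h, ⁅f, w⁆⁆ - ⁅⁅h, f⁆, w⁆ := by rw [lie_lie]; abel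
      rw [lie_add, lie_smul, this, hn, t.lie_lie_smul_f K, neg_lie, smul_lie]
      module
    have := ih key (by rw [hfw, lie_smul, hw, smul_zero])
      (by rw [hfw, lie_smul, hn, smul_comm])
    rw [hfw] at this
    refine (smul_eq_zero_iff_right ?_).mp this
    exact_mod_cast (by lia : n + 2 + k ≠ 0)

/-- In a finite-dimensional representation of `sl₂`, the kernel of `e` meets the image of `f`
trivially. -/
lemma lie_f_eq_zero_of_lie_e_lie_f_eq_zero [CharZero K] [IsAlgClosed K]
    [FiniteDimensional K M] (t : IsSl2Triple h e f) {w : M} (hw : ⁅e, ⁅f, w⁆⁆ = 0) :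
    ⁅f, w⁆ = 0 := by
  set p : Submodule K M := (toEnd K L M e).ker ⊓ (toEnd K L M f).range
  have hp : ∀ x ∈ p, toEnd K L M h x ∈ p := by
    rintro x ⟨hx, hx'⟩
    exact ⟨by simpa using t.symm.lie_h_mem_ker_f hx, t.lie_h_mem_range_f hx'⟩
  suffices p = ⊥ from (Submodule.eq_bot_iff p).mp this _ ⟨hw, w, rfl⟩
  by_contra hp0
  obtain ⟨μ, m, ⟨hme, v, rfl⟩, hm0, hm⟩ := exists_eigenvector_mem _ hp hp0
  have P : HasPrimitiveVectorWith t (toEnd K L M f v) μ := ⟨hm0, hm, hme⟩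
  obtain ⟨n, rfl⟩ := P.exists_nat
  obtain ⟨k, hk⟩ := t.isNilpotent_toEnd_e K M
  exact hm0 (t.lie_f_eq_zero_of_pow_toEnd_e_eq_zero k (by rw [hk]; rfl) hme hm)

/-- The weights of `h` on the kernel of `f` have nonpositive real part. -/
lemma re_nonpos_of_lie_f_eq_zero {M : Type*} [LieAlgebra ℂ L] [AddCommGroup M] [Module ℂ M]
    [LieRingModule L M] [LieModule ℂ L M] [FiniteDimensional ℂ M] (t : IsSl2Triple h e f)
    {μ : ℂ} {m : M} (hm0 : m ≠ 0) (hm : ⁅f, m⁆ = 0)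
    (hmμ : m ∈ (toEnd ℂ L M h).maxGenEigenspace μ) : μ.re ≤ 0 := by
  obtain ⟨v, hvf, hv0, hv⟩ := exists_eigenvector_mem_of_mem_maxGenEigenspace _
    (fun _ ↦ t.lie_h_mem_ker_f (K := ℂ)) hm hmμ hm0
  have P : HasPrimitiveVectorWith t.symm v (-μ) := ⟨hv0, by simpa using hv, hvf⟩
  obtain ⟨n, hn⟩ := P.exists_nat
  simp [neg_eq_iff_eq_neg.mp hn]

/-- For `y` centralizing `f`, the map `u ↦ ⁅f, ⁅e + y, u⁆⁆` is injective on the image of `ad f`. -/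
lemma eq_zero_of_lie_f_lie_add_eq_zero {L : Type*} [LieRing L] [LieAlgebra ℂ L]
    [FiniteDimensional ℂ L] {h e f : L} (t : IsSl2Triple h e f) {y u : L} (hy : ⁅f, y⁆ = 0)
    (hu : u ∈ (toEnd ℂ L L f).range) (hyu : ⁅f, ⁅e + y, u⁆⁆ = 0) : u = 0 := by
  set H := toEnd ℂ L L h
  have eigen {z : L} {c : ℂ} (hz : ⁅h, z⁆ = c • z) : z ∈ H.maxGenEigenspace c :=
    End.mem_maxGenEigenspace H c z |>.mpr ⟨1, by simp [H, hz]⟩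
  have hf_eigen : f ∈ H.maxGenEigenspace (-2) :=
    eigen (by rw [t.lie_lie_smul_f ℂ, neg_smul])
  have hH_top : ⨆ μ, H.maxGenEigenspace μ = ⊤ := End.iSup_maxGenEigenspace_eq_top H
  rw [Submodule.eq_iSup_inf_genEigenspace ⊤ (fun _ ↦ t.lie_h_mem_range_f) hH_top,
    Submodule.mem_iSup_iff_exists_finsupp] at hu
  obtain ⟨g, hg, rfl⟩ := hu
  have hy' : y ∈ (toEnd ℂ L L f).ker := hy
  rw [Submodule.eq_iSup_inf_genEigenspace ⊤ (fun _ ↦ t.lie_h_mem_ker_f) hH_top,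
    Submodule.mem_iSup_iff_exists_finsupp] at hy'
  obtain ⟨q, hq, rfl⟩ := hy'
  by_contra hne
  have hsupp : g.support.Nonempty := by
    rw [Finsupp.support_nonempty_iff]; rintro rfl; simp at hne
  obtain ⟨μ, hμ, hmax⟩ := g.support.exists_max_image Complex.re hsupp
  have hfe (ν : ℂ) : ⁅f, ⁅e, g ν⁆⁆ ∈ H.maxGenEigenspace ν := by
    have := lie_mem_maxGenEigenspace_toEnd hf_eigen
      (lie_mem_maxGenEigenspace_toEnd (eigen (t.lie_h_e_smul ℂ)) (hg ν).2)
    simpa using this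
  have hfq (ν ρ : ℂ) : ⁅f, ⁅q ν, g ρ⁆⁆ ∈ H.maxGenEigenspace (-2 + (ν + ρ)) :=
    lie_mem_maxGenEigenspace_toEnd hf_eigen
      (lie_mem_maxGenEigenspace_toEnd (hq ν).2 (hg ρ).2)
  set W := ⨆ ν ∈ {ν : ℂ | ν ≠ μ}, H.maxGenEigenspace ν
  have mem_W {ν : ℂ} (hν : ν ≠ μ) {z : L} (hz : z ∈ H.maxGenEigenspace ν) : z ∈ W :=
    Submodule.mem_iSup_of_mem ν (Submodule.mem_iSup_of_mem hν hz)
  have hdisj : Disjoint (H.maxGenEigenspace μ) W :=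
    H.independent_maxGenEigenspace.disjoint_biSup (by simp)
  have hsum : ⁅f, ⁅e, g μ⁆⁆ = -(∑ ν ∈ g.support.erase μ, ⁅f, ⁅e, g ν⁆⁆) -
      ∑ ν ∈ q.support, ∑ ρ ∈ g.support, ⁅f, ⁅q ν, g ρ⁆⁆ := by
    rw [add_lie, lie_add, Finsupp.sum, Finsupp.sum, lie_sum, lie_sum,
      ← Finset.add_sum_erase _ _ hμ] at hyu
    simp only [sum_lie, lie_sum] at hyu
    rw [Finset.sum_comm] at hyu
    rw [← sub_eq_zero, ← hyu]
    abel
  have h0 : ⁅f, ⁅e, g μ⁆⁆ = 0 := by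
    refine Submodule.disjoint_def.mp hdisj _ (hfe μ) ?_
    rw [hsum]
    refine W.sub_mem (W.neg_mem (W.sum_mem fun ν hν ↦ mem_W (Finset.ne_of_mem_erase hν) (hfe ν)))
      (W.sum_mem fun ν hν ↦ W.sum_mem fun ρ hρ ↦ mem_W ?_ (hfq ν ρ))
    intro heq
    have h1 := t.re_nonpos_of_lie_f_eq_zero (Finsupp.mem_support_iff.mp hν) (hq ν).1 (hq ν).2
    have h2 := hmax ρ hρ
    have h3 := congr_arg Complex.re heq
    simp at h3
    linarith
  have h1 : ⁅e, g μ⁆ = 0 := t.symm.lie_f_eq_zero_of_lie_e_lie_f_eq_zero (K := ℂ) h0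
  obtain ⟨v, hv⟩ := (hg μ).1
  have h2 : ⁅e, ⁅f, v⁆⁆ = 0 := by rw [← h1, ← hv]; rfl
  exact Finsupp.mem_support_iff.mp hμ
    (hv ▸ t.lie_f_eq_zero_of_lie_e_lie_f_eq_zero (K := ℂ) h2)

end IsSl2Triple

/-- An element Killing-orthogonal to the centralizer of `f` lies in the image of `ad f`. -/
lemma mem_range_toEnd_of_killingForm_eq_zero {K L : Type*} [Field K] [LieRing L] [LieAlgebra K L]
    [FiniteDimensional K L] [LieAlgebra.IsKilling K L] {f u : L}
    (hu : ∀ v, ⁅f, v⁆ = 0 → killingForm K L u v = 0) : u ∈ (toEnd K L L f).range := by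
  have hnd := LieAlgebra.IsKilling.killingForm_nondegenerate K L
  have hrefl : (killingForm K L).IsRefl := (LieModule.traceForm_isSymm K L L).isRefl
  rw [← LinearMap.BilinForm.orthogonal_orthogonal hnd hrefl (toEnd K L L f).range]
  intro v hv
  change killingForm K L v u = 0
  rw [traceForm_comm]
  refine hu v (hnd.1 _ fun w ↦ ?_)
  have : killingForm K L ⁅f, w⁆ v = 0 := hv _ ⟨w, rfl⟩
  rw [traceForm_apply_lie_apply', traceForm_comm, this, neg_zero]

/-- For `x ∈ e + ker (ad f)`, the skew-symmetric bilinear form `B` on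
`𝔤 × ker (ad f)` given by `B((u₁,v₁),(u₂,v₂)) = -κ(x,⁅u₁,u₂⁆) - κ(u₁,v₂) + κ(u₂,v₁)`
is nondegenerate. -/
theorem stmt7 {L : Type*} [LieRing L] [LieAlgebra ℂ L]
    [Module.Finite ℂ L] [LieAlgebra.IsSemisimple ℂ L]
    (e h f : L) (he : e ≠ 0)
    (hhe : ⁅h, e⁆ = (2 : ℂ) • e) (hhf : ⁅h, f⁆ = (-2 : ℂ) • f) (hef : ⁅e, f⁆ = h)
    (x : L) (hx : ∃ y : L, ⁅f, y⁆ = 0 ∧ x = e + y) :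
    ∀ u v : L, ⁅f, v⁆ = 0 → ¬(u = 0 ∧ v = 0) →
      ∃ u' v' : L, ⁅f, v'⁆ = 0 ∧
        - killingForm ℂ L x ⁅u, u'⁆ - killingForm ℂ L u v' + killingForm ℂ L u' v ≠ 0 := by
  obtain ⟨y, hy, rfl⟩ := hx
  intro u v hv huv
  by_contra! H
  have t : IsSl2Triple h e f := by
    refine ⟨?_, hef, by rw [hhe, ofNat_smul_eq_nsmul], by
      rw [hhf, neg_smul, ofNat_smul_eq_nsmul]⟩
    rintro rfl
    rw [zero_lie, eq_comm, smul_eq_zero_iff_right two_ne_zero] at hhe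
    exact he hhe
  have hu : u ∈ (toEnd ℂ L L f).range :=
    mem_range_toEnd_of_killingForm_eq_zero fun v' hv' ↦ by simpa using H 0 v' hv'
  have hvu : v = ⁅e + y, u⁆ := by
    rw [← sub_eq_zero]
    refine (LieAlgebra.IsKilling.killingForm_nondegenerate ℂ L).1 _ fun w ↦ ?_
    have := H w 0 (lie_zero f)
    rw [map_zero, sub_zero, ← traceForm_apply_lie_apply, traceForm_comm ℂ L L w] at this
    rw [map_sub, LinearMap.sub_apply]
    linear_combination this
  have hu0 : u = 0 := t.eq_zero_of_lie_f_lie_add_eq_zero hy hu (hvu ▸ hv)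
  exact huv ⟨hu0, by rw [hvu, hu0, lie_zero]⟩
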